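/- Let C̲ be a G-coalgebra and M a right comodule over the smash coproduct C̲ ⋊ kG, with structure maps ρ_α : M → M ⊗ C_α ⊗ kG, and let M = ⊕_{σ∈G} M_σ be the grading with m ∈ M_σ iff ρ_e(m) ∈ M ⊗ C_e ⊗ kσ⁻¹. Then for every ω ∈ G, every m ∈ M_ω and every β ∈ G, one has ρ_β(m) ∈ M_{ωβ⁻¹} ⊗ C_β ⊗ kω⁻¹. -/

import Mathlib

open TensorProduct

universe u

/-- A `G`-group coalgebra over `k`: a family of `k`-vector spaces `C α` with
comultiplications `Δ_{α,β} : C (α*β) → C α ⊗ C β` and a counit `ε : C 1 → k`.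
The comultiplication takes an explicit proof `γ = α * β` to avoid dependent casts. -/
structure GCoalgebra (k : Type u) [Field k] (G : Type u) [Group G] where
  C : G → Type u
  [acg : ∀ α, AddCommGroup (C α)]
  [mod : ∀ α, Module k (C α)]
  Δ : ∀ ⦃γ⦄ (α β : G), γ = α * β → (C γ →ₗ[k] C α ⊗[k] C β)
  ε : C 1 →ₗ[k] k
  coassoc : ∀ ⦃δ δ₁ δ₂ : G⦄ (α β γ : G) (h₁ : δ = δ₁ * γ) (h₁' : δ₁ = α * β)
      (h₂ : δ = α * δ₂) (h₂' : δ₂ = β * γ),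
      (TensorProduct.assoc k (C α) (C β) (C γ)).toLinearMap ∘ₗ
        (TensorProduct.map (Δ α β h₁') LinearMap.id) ∘ₗ Δ δ₁ γ h₁
      = (TensorProduct.map LinearMap.id (Δ β γ h₂')) ∘ₗ Δ α δ₂ h₂
  counit_right : ∀ (α : G) (h : α = α * 1),
      (TensorProduct.rid k (C α)).toLinearMap ∘ₗ
        (TensorProduct.map LinearMap.id ε) ∘ₗ Δ α 1 h = LinearMap.id
  counit_left : ∀ (α : G) (h : α = 1 * α),
      (TensorProduct.lid k (C α)).toLinearMap ∘ₗ
        (TensorProduct.map ε LinearMap.id) ∘ₗ Δ 1 α h = LinearMap.id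

attribute [instance] GCoalgebra.acg GCoalgebra.mod

variable {k : Type u} [Field k] {G : Type u} [Group G]

/-- A right `G`-`C̲`-comodule. -/
structure GComodule (Cc : GCoalgebra k G) where
  M : G → Type u
  [acg : ∀ α, AddCommGroup (M α)]
  [mod : ∀ α, Module k (M α)]
  ρ : ∀ ⦃γ⦄ (α β : G), γ = α * β → (M γ →ₗ[k] M α ⊗[k] Cc.C β)
  counit : ∀ (α : G) (h : α = α * 1),
      (TensorProduct.rid k (M α)).toLinearMap ∘ₗ
        (TensorProduct.map LinearMap.id Cc.ε) ∘ₗ ρ α 1 h = LinearMap.id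
  coassoc : ∀ ⦃δ δ₁ δ₂ : G⦄ (α β γ : G) (h₁ : δ = δ₁ * γ) (h₁' : δ₁ = α * β)
      (h₂ : δ = α * δ₂) (h₂' : δ₂ = β * γ),
      (TensorProduct.assoc k (M α) (Cc.C β) (Cc.C γ)).toLinearMap ∘ₗ
        (TensorProduct.map (ρ α β h₁') LinearMap.id) ∘ₗ ρ δ₁ γ h₁
      = (TensorProduct.map LinearMap.id (Cc.Δ β γ h₂')) ∘ₗ ρ α δ₂ h₂

attribute [instance] GComodule.acg GComodule.mod

/-- A morphism of right `G`-`C̲`-comodules. -/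
structure GComodHom {Cc : GCoalgebra k G} (M N : GComodule Cc) where
  φ : ∀ α, M.M α →ₗ[k] N.M α
  colinear : ∀ ⦃γ⦄ (α β : G) (h : γ = α * β),
      (TensorProduct.map (φ α) LinearMap.id) ∘ₗ M.ρ α β h = N.ρ α β h ∘ₗ φ γ

/-- A `G`-coalgebra is strong if all comultiplication maps are injective. -/
def GCoalgebra.Strong (Cc : GCoalgebra k G) : Prop :=
  ∀ (α β : G), Function.Injective (Cc.Δ α β rfl)
/-- The map `kG → kG ⊗ kG`, `σ ↦ βσ ⊗ σ`. -/
noncomputable def smashW (β : G) : (G →₀ k) →ₗ[k] (G →₀ k) ⊗[k] (G →₀ k) :=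
  Finsupp.lsum k fun σ => LinearMap.toSpanSingleton k _
    (Finsupp.single (β * σ) (1 : k) ⊗ₜ Finsupp.single σ (1 : k))

/-- The augmentation `kG → k`, `σ ↦ 1`. -/
noncomputable def smashAug : (G →₀ k) →ₗ[k] k :=
  Finsupp.lsum k fun _ => LinearMap.id

/-- The comultiplication `Δ_{α,β}` of the smash coproduct `C̲ ⋊ kG`:
`Δ_{α,β}(c ⊗ σ) = (c_{(1,α)} ⊗ βσ) ⊗ (c_{(2,β)} ⊗ σ)`. -/
noncomputable def smashΔ (Cc : GCoalgebra k G) ⦃γ : G⦄ (α β : G) (h : γ = α * β) :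
    (Cc.C γ ⊗[k] (G →₀ k)) →ₗ[k]
      (Cc.C α ⊗[k] (G →₀ k)) ⊗[k] (Cc.C β ⊗[k] (G →₀ k)) :=
  (TensorProduct.tensorTensorTensorComm k (Cc.C α) (Cc.C β)
      (G →₀ k) (G →₀ k)).toLinearMap ∘ₗ
    TensorProduct.map (Cc.Δ α β h) (smashW β)

/-- The counit of the smash coproduct: `ε(c ⊗ σ) = ε(c)`. -/
noncomputable def smashε (Cc : GCoalgebra k G) : (Cc.C 1 ⊗[k] (G →₀ k)) →ₗ[k] k :=
  LinearMap.mul' k k ∘ₗ TensorProduct.map Cc.ε smashAug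
/-- A right comodule over the smash coproduct `C̲ ⋊ kG`. -/
structure SmashComodule (Cc : GCoalgebra k G) where
  X : Type u
  [acg : AddCommGroup X]
  [mod : Module k X]
  ρ : ∀ α : G, X →ₗ[k] X ⊗[k] (Cc.C α ⊗[k] (G →₀ k))
  counit : (TensorProduct.rid k X).toLinearMap ∘ₗ
      (TensorProduct.map LinearMap.id (smashε Cc)) ∘ₗ ρ 1 = LinearMap.id
  coassoc : ∀ ⦃γ : G⦄ (α β : G) (h : γ = α * β),
      (TensorProduct.assoc k X (Cc.C α ⊗[k] (G →₀ k))
          (Cc.C β ⊗[k] (G →₀ k))).toLinearMap ∘ₗ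
        (TensorProduct.map (ρ α) LinearMap.id) ∘ₗ ρ β
      = (TensorProduct.map LinearMap.id (smashΔ Cc α β h)) ∘ₗ ρ γ

attribute [instance] SmashComodule.acg SmashComodule.mod

/-- The embedding `X ⊗ C_α → X ⊗ (C_α ⊗ kG)`, `x ⊗ c ↦ x ⊗ (c ⊗ σ)`, whose range is
`X ⊗ C_α ⊗ kσ`. -/
noncomputable def smashEmb (Cc : GCoalgebra k G) (X : Type u) [AddCommGroup X]
    [Module k X] (α σ : G) :
    (X ⊗[k] Cc.C α) →ₗ[k] X ⊗[k] (Cc.C α ⊗[k] (G →₀ k)) :=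
  LinearMap.lTensor X ((TensorProduct.mk k (Cc.C α) (G →₀ k)).flip
    (Finsupp.single σ (1 : k)))

/-- The `τ`-component projection `X ⊗ (C_α ⊗ kG) → X ⊗ C_α` obtained by evaluating
the `kG`-coordinate at `τ`. -/
noncomputable def smashProj (Cc : GCoalgebra k G) (X : Type u) [AddCommGroup X]
    [Module k X] (α τ : G) :
    (X ⊗[k] (Cc.C α ⊗[k] (G →₀ k))) →ₗ[k] X ⊗[k] Cc.C α :=
  LinearMap.lTensor X ((TensorProduct.rid k (Cc.C α)).toLinearMap ∘ₗ
    LinearMap.lTensor (Cc.C α) (Finsupp.lapply τ))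

/-- The degree-`σ` part `M_σ = {m : ρ_e(m) ∈ M ⊗ C_e ⊗ kσ⁻¹}` of a right
`C̲ ⋊ kG`-comodule. -/
noncomputable def SmashComodule.grade {Cc : GCoalgebra k G} (M : SmashComodule Cc)
    (σ : G) : Submodule k M.X :=
  Submodule.comap (M.ρ 1) (LinearMap.range (smashEmb Cc M.X 1 σ⁻¹))

/-- The map `(c ⊗ a) ⊗ (d ⊗ b) ↦ ε(d) • (c ⊗ (aug a) b)`. -/
noncomputable def smashContract (Cc : GCoalgebra k G) (β : G) :
    (Cc.C β ⊗[k] (G →₀ k)) ⊗[k] (Cc.C 1 ⊗[k] (G →₀ k)) →ₗ[k] Cc.C β ⊗[k] (G →₀ k) :=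
  TensorProduct.map (TensorProduct.rid k (Cc.C β)).toLinearMap
      (TensorProduct.lid k (G →₀ k)).toLinearMap ∘ₗ
    TensorProduct.map (TensorProduct.map LinearMap.id Cc.ε)
      (TensorProduct.map smashAug LinearMap.id) ∘ₗ
    (TensorProduct.tensorTensorTensorComm k (Cc.C β) (G →₀ k) (Cc.C 1) (G →₀ k)).toLinearMap

lemma smashW_single (β σ : G) :
    smashW (k := k) β (Finsupp.single σ 1) = Finsupp.single (β * σ) 1 ⊗ₜ Finsupp.single σ 1 := by
  simp [smashW]

lemma smashAug_single {G : Type u} (σ : G) (a : k) : smashAug (Finsupp.single σ a) = a := by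
  simp [smashAug]

lemma lid_smashAug_smashW (β : G) :
    (TensorProduct.lid k (G →₀ k)).toLinearMap ∘ₗ
      TensorProduct.map smashAug LinearMap.id ∘ₗ smashW β = LinearMap.id := by
  ext σ : 2
  simp [smashW_single, smashAug_single]

lemma smashContract_comp_smashΔ (Cc : GCoalgebra k G) (β : G) (h : β = β * 1) :
    smashContract Cc β ∘ₗ smashΔ Cc β 1 h = LinearMap.id := by
  have hcomm : ∀ z, (TensorProduct.tensorTensorTensorComm k (Cc.C β) (G →₀ k) (Cc.C 1)
      (G →₀ k)) ((TensorProduct.tensorTensorTensorComm k (Cc.C β) (Cc.C 1) (G →₀ k)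
      (G →₀ k)) z) = z := by
    intro z
    rw [← TensorProduct.tensorTensorTensorComm_symm]
    exact LinearEquiv.symm_apply_apply _ z
  refine TensorProduct.ext' fun c a => ?_
  have h₁ := LinearMap.congr_fun (Cc.counit_right β h) c
  have h₂ := LinearMap.congr_fun (lid_smashAug_smashW (k := k) (1 : G)) a
  simp only [LinearMap.comp_apply, LinearEquiv.coe_coe, LinearMap.id_apply] at h₁ h₂
  simp [smashContract, smashΔ, hcomm, h₁, h₂]

/-- Homogeneous elements of degree `ω` are sent by every `ρ β` into `M ⊗ C_β ⊗ kω⁻¹`. -/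
lemma SmashComodule.ρ_mem_range_smashEmb {Cc : GCoalgebra k G} (M : SmashComodule Cc)
    {ω : G} {m : M.X} (hm : m ∈ M.grade ω) (β : G) :
    M.ρ β m ∈ LinearMap.range (smashEmb Cc M.X β ω⁻¹) := by
  obtain ⟨y, hy⟩ := hm
  have hco := congrArg (LinearMap.lTensor M.X (smashContract Cc β))
    (LinearMap.congr_fun (M.coassoc β 1 (mul_one β).symm) m)
  simp only [LinearMap.comp_apply, LinearEquiv.coe_coe, ← hy] at hco
  rw [← LinearMap.lTensor_def, ← LinearMap.lTensor_comp_apply, smashContract_comp_smashΔ,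
    LinearMap.lTensor_id, LinearMap.id_apply] at hco
  rw [← hco]
  clear hco hy
  induction y with
  | zero => simp
  | add y₁ y₂ h₁ h₂ => simp only [map_add]; exact add_mem h₁ h₂
  | tmul x d =>
    simp only [smashEmb, LinearMap.lTensor_tmul, LinearMap.flip_apply, TensorProduct.mk_apply,
      TensorProduct.map_tmul, LinearMap.id_apply]
    generalize M.ρ β x = z
    induction z with
    | zero => simp
    | add z₁ z₂ h₁ h₂ => simp only [TensorProduct.add_tmul, map_add]; exact add_mem h₁ h₂
    | tmul x' t =>
      induction t with
      | zero => simp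
      | add t₁ t₂ h₁ h₂ =>
        simp only [TensorProduct.tmul_add, TensorProduct.add_tmul, map_add]
        exact add_mem h₁ h₂
      | tmul c a =>
        refine ⟨x' ⊗ₜ (smashAug a • Cc.ε d • c), ?_⟩
        simp only [smashContract, LinearMap.lTensor_tmul, LinearMap.flip_apply,
          TensorProduct.mk_apply, LinearMap.comp_apply, LinearEquiv.coe_coe,
          TensorProduct.assoc_tmul, TensorProduct.tensorTensorTensorComm_tmul,
          TensorProduct.map_tmul, LinearMap.id_apply, TensorProduct.rid_tmul,
          TensorProduct.lid_tmul, TensorProduct.smul_tmul]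

lemma smashAug_smashΔ_single (Cc : GCoalgebra k G) (α β σ : G) ⦃γ : G⦄ (h : γ = α * β) :
    LinearMap.lTensor _ ((TensorProduct.rid k (Cc.C β)).toLinearMap ∘ₗ
        LinearMap.lTensor (Cc.C β) smashAug) ∘ₗ smashΔ Cc α β h ∘ₗ
        (TensorProduct.mk k (Cc.C γ) (G →₀ k)).flip (Finsupp.single σ 1) =
      LinearMap.rTensor _ ((TensorProduct.mk k (Cc.C α) (G →₀ k)).flip
        (Finsupp.single (β * σ) 1)) ∘ₗ Cc.Δ α β h := by
  ext c
  simp only [smashΔ, LinearMap.comp_apply, LinearMap.flip_apply, TensorProduct.mk_apply,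
    TensorProduct.map_tmul, smashW_single, LinearEquiv.coe_coe]
  induction Cc.Δ α β h c with
  | zero => simp
  | add z₁ z₂ h₁ h₂ => simp only [TensorProduct.add_tmul, map_add, h₁, h₂]
  | tmul c₁ c₂ => simp [smashAug_single]

lemma smashAug_smashEmb (Cc : GCoalgebra k G) (X : Type u) [AddCommGroup X] [Module k X]
    (β σ : G) :
    LinearMap.lTensor X ((TensorProduct.rid k (Cc.C β)).toLinearMap ∘ₗ
      LinearMap.lTensor (Cc.C β) smashAug) ∘ₗ smashEmb Cc X β σ = LinearMap.id := by
  refine TensorProduct.ext' fun x c => ?_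
  simp [smashEmb, smashAug_single]

/-- If `ρ β m = x ⊗ τ`, then `(ρ 1 ⊗ id) x` lies in `(M ⊗ C_1 ⊗ kβτ) ⊗ C_β`. -/
lemma SmashComodule.rTensor_ρ_mem_range {Cc : GCoalgebra k G} (M : SmashComodule Cc)
    {β τ : G} {m : M.X} {x : M.X ⊗[k] Cc.C β} (hx : smashEmb Cc M.X β τ x = M.ρ β m) :
    LinearMap.rTensor (Cc.C β) (M.ρ 1) x ∈
      LinearMap.range (LinearMap.rTensor (Cc.C β) (smashEmb Cc M.X 1 (β * τ))) := by
  set L := (TensorProduct.rid k (Cc.C β)).toLinearMap ∘ₗ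
    LinearMap.lTensor (Cc.C β) smashAug with hL
  have hco := LinearMap.congr_fun (M.coassoc 1 β (one_mul β).symm) m
  simp only [LinearMap.comp_apply, LinearEquiv.coe_coe, ← hx] at hco
  rw [← LinearEquiv.eq_symm_apply] at hco
  have hleft : LinearMap.lTensor _ L (TensorProduct.map (M.ρ 1) LinearMap.id
      (smashEmb Cc M.X β τ x)) = LinearMap.rTensor (Cc.C β) (M.ρ 1) x := by
    have := LinearMap.congr_fun (smashAug_smashEmb Cc M.X β τ) x
    rw [LinearMap.comp_apply, ← hL, LinearMap.id_apply] at this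
    conv_rhs => rw [← this]
    generalize smashEmb Cc M.X β τ x = t
    rw [← LinearMap.rTensor_def, ← LinearMap.comp_apply, ← LinearMap.comp_apply,
      LinearMap.lTensor_comp_rTensor, LinearMap.rTensor_comp_lTensor]
  refine ⟨(TensorProduct.assoc k _ _ _).symm
    (LinearMap.lTensor M.X (Cc.Δ 1 β (one_mul β).symm) x), ?_⟩
  rw [← hleft, hco]
  clear hleft hco hx
  induction x with
  | zero => simp
  | add x₁ x₂ h₁ h₂ => simp only [map_add, h₁, h₂]
  | tmul x c =>
    have hc := LinearMap.congr_fun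
      (smashAug_smashΔ_single Cc 1 β τ (one_mul β).symm) c
    simp only [LinearMap.comp_apply, ← hL, LinearMap.flip_apply, TensorProduct.mk_apply] at hc
    have hassoc : ∀ t, LinearMap.lTensor _ L ((TensorProduct.assoc k M.X
        (Cc.C 1 ⊗[k] (G →₀ k)) (Cc.C β ⊗[k] (G →₀ k))).symm (x ⊗ₜ t)) =
        (TensorProduct.assoc k M.X (Cc.C 1 ⊗[k] (G →₀ k)) (Cc.C β)).symm
          (x ⊗ₜ LinearMap.lTensor _ L t) := by
      intro t
      induction t with
      | zero => simp
      | add t₁ t₂ h₁ h₂ => simp only [TensorProduct.tmul_add, map_add, h₁, h₂]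
      | tmul a b => simp
    simp only [smashEmb, LinearMap.lTensor_tmul, LinearMap.flip_apply, TensorProduct.mk_apply,
      TensorProduct.map_tmul, LinearMap.id_apply]
    rw [hassoc, hc]
    induction Cc.Δ 1 β (one_mul β).symm c with
    | zero => simp
    | add t₁ t₂ h₁ h₂ => simp only [TensorProduct.tmul_add, map_add, h₁, h₂]
    | tmul a b => simp

/-- **Lemma 2.4.** For a right `C̲ ⋊ kG`-comodule `M`, `ω ∈ G` and `m ∈ M_ω`, one has
`ρ_β(m) ∈ M_{ωβ⁻¹} ⊗ C_β ⊗ kω⁻¹` for all `β ∈ G`. -/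
theorem smash_comodule_grade_coaction (Cc : GCoalgebra k G) (M : SmashComodule Cc)
    (ω : G) (m : M.X) (hm : m ∈ M.grade ω) (β : G) :
    M.ρ β m ∈ LinearMap.range
      (TensorProduct.map (M.grade (ω * β⁻¹)).subtype
        ((TensorProduct.mk k (Cc.C β) (G →₀ k)).flip (Finsupp.single ω⁻¹ (1 : k)))) := by
  obtain ⟨x, hx⟩ := M.ρ_mem_range_smashEmb hm β
  obtain ⟨y, hy⟩ := M.rTensor_ρ_mem_range hx
  set q := (LinearMap.range (smashEmb Cc M.X 1 (ω * β⁻¹)⁻¹)).mkQ ∘ₗ M.ρ 1 with hq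
  have hker : LinearMap.ker q = M.grade (ω * β⁻¹) := by
    rw [hq, LinearMap.ker_comp, Submodule.ker_mkQ, SmashComodule.grade]
  have hex : Function.Exact (M.grade (ω * β⁻¹)).subtype q := by
    rw [LinearMap.exact_iff, hker, Submodule.range_subtype]
  have hx0 : LinearMap.rTensor (Cc.C β) q x = 0 := by
    rw [hq, LinearMap.rTensor_comp_apply, ← hy, ← LinearMap.rTensor_comp_apply, mul_inv_rev,
      inv_inv, LinearMap.range_mkQ_comp, LinearMap.rTensor_zero, LinearMap.zero_apply]
  obtain ⟨z, hz⟩ := (Module.Flat.rTensor_exact (Cc.C β) hex x).1 hx0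
  refine ⟨z, ?_⟩
  rw [← hx, ← hz, smashEmb, ← LinearMap.comp_apply, LinearMap.lTensor_comp_rTensor]
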